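/- Let ρ' be the restriction of scalars to F_p of an absolutely irreducible representation ρ of G over a finite field F that is not realizable over a proper subfield. Then ρ' ⊗_{F_p} F decomposes as the direct sum of the Galois twists ρ^σ for σ ∈ Gal(F/F_p), and these twists are pairwise non-isomorphic irreducible representations. -/

import Mathlib

open TensorProduct

theorem aux_dedekind {F : Type*} [Field F] {ι : Type*} [Fintype ι] (s : ι → (F ≃+* F))
    (hs : Function.Injective s) (c : ι → F) (h : ∀ x : F, ∑ i, c i * s i x = 0) (i : ι) :
    c i = 0 := by
  have h1 := linearIndependent_monoidHom F F
  have h2 := h1.comp (fun i => ((s i : F →+* F) : F →* F)) (by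
    intro i j hij
    apply hs
    ext x
    exact DFunLike.congr_fun hij x)
  refine Fintype.linearIndependent_iff.mp h2 c ?_ i
  ext x
  simpa using h x

theorem aux_norm {F : Type*} [Field F] [Finite F] (α : F ≃+* F) (c : F) (hc : α c = c) :
    ∃ a : F, ∏ i ∈ Finset.range (orderOf α), (α ^ i) a = c := by
  classical
  have : Finite (F ≃+* F) := Finite.of_injective (fun e : F ≃+* F => (e : F → F))
    DFunLike.coe_injective
  let H := Subgroup.zpowers α
  have : Fintype H := Fintype.ofFinite _
  let K := FixedPoints.subfield H F
  have hcK : c ∈ K := by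
    rintro ⟨g, hg⟩
    change g c = c
    have : H ≤ MulAction.stabilizer (F ≃+* F) c := by
      rw [Subgroup.zpowers_le]
      exact hc
    exact this hg
  obtain ⟨a, ha⟩ := FiniteField.norm_surjective K F ⟨c, hcK⟩
  refine ⟨a, ?_⟩
  have h1 := Algebra.norm_eq_prod_automorphisms K a
  rw [ha] at h1
  change c = _ at h1
  rw [h1, ← (FixedPoints.toAlgAutMulEquiv H F).toEquiv.prod_comp, Finset.prod_range,
    ← (finEquivZPowers (isOfFinOrder_of_finite α)).prod_comp]
  rfl

theorem aux_descent {F : Type*} [Field F] [Finite F] {n : ℕ} (α : F ≃+* F)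
    (φ : (Fin n → F) →+ (Fin n → F)) (hφ : ∀ (c : F) x, φ (c • x) = α c • φ x)
    (hd : ∀ x, φ^[orderOf α] x = x) : ⊤ ≤ Submodule.span F {x | φ x = x} := by
  classical
  have hfin : Finite (F ≃+* F) := Finite.of_injective (fun e : F ≃+* F => (e : F → F))
    DFunLike.coe_injective
  have hit : ∀ (i : ℕ) (c : F) x, φ^[i] (c • x) = (α ^ i) c • φ^[i] x := by
    intro i c x
    induction i with
    | zero => simp
    | succ k ih =>
      rw [Function.iterate_succ_apply', ih, hφ, Function.iterate_succ_apply', pow_succ']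
      rfl
  by_contra hlt
  obtain ⟨f, hf, hle⟩ := Submodule.exists_le_ker_of_lt_top _ (lt_top_iff_ne_top.mpr
    (fun h => hlt h.ge))
  apply hf
  refine LinearMap.ext fun x => ?_
  have hs : Function.Injective (fun i : Fin (orderOf α) => α ^ (i : ℕ)) := by
    intro i j hij
    exact Fin.ext (pow_injOn_Iio_orderOf i.2 j.2 hij)
  have hd0 : 0 < orderOf α := orderOf_pos α
  have key := aux_dedekind _ hs (fun i => f (φ^[(i : ℕ)] x)) (fun c => by
    have hmem : (∑ i ∈ Finset.range (orderOf α), φ^[i] (c • x)) ∈ {x | φ x = x} := by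
      change φ _ = _
      rw [map_sum]
      have e1 : ∀ i, φ (φ^[i] (c • x)) = φ^[i+1] (c • x) := fun i =>
        (Function.iterate_succ_apply' φ i (c • x)).symm
      simp only [e1]
      have h1 := Finset.sum_range_succ (fun i => φ^[i] (c • x)) (orderOf α)
      have h2 := Finset.sum_range_succ' (fun i => φ^[i] (c • x)) (orderOf α)
      rw [h1, hd] at h2
      exact (add_right_cancel h2).symm
    have h3 : f (∑ i ∈ Finset.range (orderOf α), φ^[i] (c • x)) = 0 :=
      hle (Submodule.subset_span hmem)
    rw [map_sum, Finset.sum_range] at h3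
    rw [← h3]
    refine Finset.sum_congr rfl fun i _ => ?_
    rw [hit, map_smul, smul_eq_mul, mul_comm]) ⟨0, hd0⟩
  simpa using key

theorem aux_realize {F : Type*} [Field F] [Finite F] {G : Type*} {n : ℕ}
    (α : F ≃+* F) (ρ : G → GL (Fin n) F)
    (hcomm : ∀ f : Matrix (Fin n) (Fin n) F,
      (∀ g : G, f * (ρ g : Matrix (Fin n) (Fin n) F) = (ρ g : Matrix (Fin n) (Fin n) F) * f) →
      ∃ c : F, f = c • (1 : Matrix (Fin n) (Fin n) F))
    (M : GL (Fin n) F)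
    (hM : ∀ g, (M : Matrix (Fin n) (Fin n) F) * (ρ g : Matrix (Fin n) (Fin n) F)
      = (ρ g : Matrix (Fin n) (Fin n) F).map α * (M : Matrix (Fin n) (Fin n) F)) :
    ∃ P : GL (Fin n) F, ∀ g i j,
      α ((↑(P⁻¹ * ρ g * P) : Matrix (Fin n) (Fin n) F) i j) =
        (↑(P⁻¹ * ρ g * P) : Matrix (Fin n) (Fin n) F) i j := by
  classical
  rcases Nat.eq_zero_or_pos n with rfl | hn
  · exact ⟨1, fun g i => i.elim0⟩
  have hmap : ∀ (A : Matrix (Fin n) (Fin n) F) (x : Fin n → F),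
      (fun i => α (A.mulVec x i)) = (A.map α).mulVec (fun i => α (x i)) := by
    intro A x
    ext i
    exact RingHom.map_mulVec (α : F →+* F) A x i
  -- the semilinear map
  let φ : (Fin n → F) →+ (Fin n → F) :=
    { toFun := fun x => (↑(M⁻¹) : Matrix (Fin n) (Fin n) F).mulVec (fun i => α (x i))
      map_zero' := by
        have : (fun i : Fin n => α ((0 : Fin n → F) i)) = 0 := by ext; simp
        rw [this, Matrix.mulVec_zero]
      map_add' := fun x y => by
        rw [← Matrix.mulVec_add]
        congr 1
        ext; simp }
  have hφd : ∀ x, φ x = (↑(M⁻¹) : Matrix (Fin n) (Fin n) F).mulVec (fun i => α (x i)) :=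
    fun x => rfl
  have hφs : ∀ (c : F) x, φ (c • x) = α c • φ x := by
    intro c x
    rw [hφd, hφd, ← Matrix.mulVec_smul]
    congr 1
    ext; simp
  have hM' : ∀ g, (↑(M⁻¹) : Matrix (Fin n) (Fin n) F) * (ρ g : Matrix (Fin n) (Fin n) F).map α
      = (ρ g : Matrix (Fin n) (Fin n) F) * (↑(M⁻¹) : Matrix (Fin n) (Fin n) F) := by
    intro g
    rw [Units.inv_mul_eq_iff_eq_mul, ← mul_assoc, hM, mul_assoc, Units.mul_inv, mul_one]
  have hφρ : ∀ g x, φ ((ρ g : Matrix (Fin n) (Fin n) F).mulVec x) =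
      (ρ g : Matrix (Fin n) (Fin n) F).mulVec (φ x) := by
    intro g x
    rw [hφd, hφd, hmap, Matrix.mulVec_mulVec, Matrix.mulVec_mulVec, hM']
  have hφinj : Function.Injective φ := by
    intro x y hxy
    rw [hφd, hφd] at hxy
    have h1 := congrArg (fun v => (M : Matrix (Fin n) (Fin n) F).mulVec v) hxy
    simp only [Matrix.mulVec_mulVec, Units.mul_inv, Matrix.one_mulVec] at h1
    ext i
    exact α.injective (congrFun h1 i)
  have hit : ∀ (i : ℕ) (c : F) x, φ^[i] (c • x) = (α ^ i) c • φ^[i] x := by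
    intro i c x
    induction i with
    | zero => simp
    | succ k ih =>
      rw [Function.iterate_succ_apply', ih, hφs, Function.iterate_succ_apply', pow_succ']
      rfl
  have hitadd : ∀ (i : ℕ) x y, φ^[i] (x + y) = φ^[i] x + φ^[i] y := by
    intro i x y
    induction i with
    | zero => rfl
    | succ k ih => simp only [Function.iterate_succ_apply', ih, map_add]
  have hitρ : ∀ (i : ℕ) g x, φ^[i] ((ρ g : Matrix (Fin n) (Fin n) F).mulVec x) =
      (ρ g : Matrix (Fin n) (Fin n) F).mulVec (φ^[i] x) := by
    intro i g x
    induction i with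
    | zero => rfl
    | succ k ih => simp only [Function.iterate_succ_apply', ih, hφρ]
  set d := orderOf α with hd
  let L : (Fin n → F) →ₗ[F] (Fin n → F) :=
    { toFun := φ^[d]
      map_add' := hitadd d
      map_smul' := fun c x => by
        rw [hit, hd, pow_orderOf_eq_one]; rfl }
  obtain ⟨c, hc⟩ := hcomm (LinearMap.toMatrix' L) (fun g => by
    apply Matrix.toLin'.injective
    rw [Matrix.toLin'_mul, Matrix.toLin'_mul, Matrix.toLin'_toMatrix']
    refine LinearMap.ext fun x => ?_
    exact hitρ d g x)
  have hLc : ∀ x, φ^[d] x = c • x := by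
    intro x
    have h1 : L = Matrix.toLin' (c • (1 : Matrix (Fin n) (Fin n) F)) := by
      rw [← hc, Matrix.toLin'_toMatrix']
    have h2 := LinearMap.congr_fun h1 x
    rw [map_smul, Matrix.toLin'_one] at h2
    exact h2
  let v : Fin n → F := fun _ => 1
  have hv : v ≠ 0 := fun h => one_ne_zero (congrFun h ⟨0, hn⟩)
  have hφv : φ v ≠ 0 := fun h => hv (hφinj (h.trans (map_zero φ).symm))
  have hc0 : c ≠ 0 := by
    rintro rfl
    have h1 := hLc v
    rw [zero_smul] at h1
    have h2 : φ^[d] 0 = 0 := by rw [hLc, zero_smul]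
    exact hv (hφinj.iterate d (h1.trans h2.symm))
  have hcα : α c = c := by
    have h1 : φ (φ^[d] v) = φ^[d] (φ v) := by
      rw [← Function.iterate_succ_apply' φ, Function.iterate_succ_apply]
    rw [hLc, hLc, hφs] at h1
    exact smul_left_injective F hφv h1
  obtain ⟨a, ha⟩ := aux_norm α c⁻¹ (by rw [map_inv₀, hcα])
  let ψ : (Fin n → F) →+ (Fin n → F) := (DistribSMul.toAddMonoidHom (Fin n → F) a).comp φ
  have hψ : ∀ x, ψ x = a • φ x := fun x => rfl
  have hψs : ∀ (c : F) x, ψ (c • x) = α c • ψ x := by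
    intro c x
    rw [hψ, hψ, hφs, smul_comm]
  have hψit : ∀ (i : ℕ) x, ψ^[i] x = (∏ j ∈ Finset.range i, (α ^ j) a) • φ^[i] x := by
    intro i
    induction i with
    | zero => intro x; simp
    | succ k ih =>
      intro x
      rw [Function.iterate_succ_apply, ih, hψ, hit, Finset.prod_range_succ, mul_smul,
        Function.iterate_succ_apply]
  have hspan := aux_descent α ψ hψs (fun x => by
    rw [hψit, ha, ← hd, hLc, smul_smul, inv_mul_cancel₀ hc0, one_smul])
  let b₀ := Module.Basis.ofSpan hspan
  have hb₀ : ∀ i, ψ (b₀ i) = b₀ i := fun i => Module.Basis.ofSpan_subset hspan ⟨i, rfl⟩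
  let b : Module.Basis (Fin n) F (Fin n → F) := b₀.reindex (b₀.indexEquiv (Pi.basisFun F (Fin n)))
  have hb : ∀ i, ψ (b i) = b i := fun i => by
    rw [Module.Basis.reindex_apply]; exact hb₀ _
  let P₀ := (Pi.basisFun F (Fin n)).toMatrix b
  have hP₀ : ∀ i j, P₀ i j = b j i := fun i j => by
    simp [P₀, Module.Basis.toMatrix_apply]
  let P : GL (Fin n) F := ⟨P₀, b.toMatrix (Pi.basisFun F (Fin n)),
    Module.Basis.toMatrix_mul_toMatrix_flip _ _, Module.Basis.toMatrix_mul_toMatrix_flip _ _⟩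
  have hPm : ∀ j, (P : Matrix (Fin n) (Fin n) F).mulVec (Pi.single j 1) = b j := by
    intro j
    ext i
    rw [Matrix.mulVec_single_one]
    exact hP₀ i j
  -- `P` is fixed by `ψ`
  have hPα : a • ((P : Matrix (Fin n) (Fin n) F).map α)
      = (M : Matrix (Fin n) (Fin n) F) * (P : Matrix (Fin n) (Fin n) F) := by
    have h1 : a • ((↑(M⁻¹) : Matrix (Fin n) (Fin n) F) * (P : Matrix (Fin n) (Fin n) F).map α)
        = (P : Matrix (Fin n) (Fin n) F) := by
      ext i j
      have h2 := congrFun (hb j) i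
      rw [hψ, hφd] at h2
      rw [show (P : Matrix (Fin n) (Fin n) F) i j = b j i from hP₀ i j, ← h2]
      simp only [Matrix.smul_apply, Pi.smul_apply, Matrix.mul_apply, Matrix.mulVec, dotProduct,
        Matrix.map_apply]
      congr 1
    rw [← h1]
    simp only [Matrix.mul_smul, ← mul_assoc, Units.mul_inv, one_mul]
    rw [h1]
  refine ⟨P, fun g i j => ?_⟩
  set Q : Matrix (Fin n) (Fin n) F := (↑(P⁻¹ * ρ g * P) : Matrix (Fin n) (Fin n) F) with hQ
  have hPQ : (P : Matrix (Fin n) (Fin n) F) * Q = (ρ g : Matrix (Fin n) (Fin n) F) * P := by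
    rw [hQ]
    simp only [Units.val_mul, ← mul_assoc, Units.mul_inv, one_mul]
  suffices h : Q.map α = Q by
    exact congrFun (congrFun h i) j
  have h3 : (P : Matrix (Fin n) (Fin n) F).map α * Q.map α =
      (ρ g : Matrix (Fin n) (Fin n) F).map α * (P : Matrix (Fin n) (Fin n) F).map α := by
    rw [← Matrix.map_mul, hPQ, Matrix.map_mul]
  have h4 : (M : Matrix (Fin n) (Fin n) F) * P * Q.map α
      = (M : Matrix (Fin n) (Fin n) F) * P * Q := by
    rw [mul_assoc _ _ Q, hPQ, ← mul_assoc, hM, mul_assoc _ _ (P : Matrix (Fin n) (Fin n) F), ← hPα,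
      Matrix.smul_mul, h3, Matrix.mul_smul]
  rw [← Units.val_mul] at h4
  exact (Units.mul_right_inj (M * P)).mp h4

/-- Let `ρ'` be the restriction of scalars to `𝔽_p` of an absolutely irreducible
representation `ρ` of `G` over a finite field `F` (absolute irreducibility encoded by
irreducibility plus scalar commutant) that is not realizable over a proper subfield.  Then
`ρ' ⊗_{𝔽_p} F` decomposes as the direct sum of the Galois twists `ρ^σ` for
`σ ∈ Gal(F/𝔽_p)` (which, for a finite field, is the group of all ring automorphisms of `F`),
and these twists are pairwise non-isomorphic irreducible representations. -/
theorem stmt2 {p : ℕ} [Fact p.Prime] {F : Type*} [Field F] [Fintype F] [CharP F p]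
    [Algebra (ZMod p) F]
    {G : Type*} [Group G] {n : ℕ} (ρ : G →* GL (Fin n) F)
    (hirr : ∀ U : Submodule F (Fin n → F),
      (∀ g : G, ∀ x ∈ U, (ρ g : Matrix (Fin n) (Fin n) F).mulVec x ∈ U) → U = ⊥ ∨ U = ⊤)
    (hcomm : ∀ f : Matrix (Fin n) (Fin n) F,
      (∀ g : G, f * (ρ g : Matrix (Fin n) (Fin n) F) = (ρ g : Matrix (Fin n) (Fin n) F) * f) →
      ∃ c : F, f = c • (1 : Matrix (Fin n) (Fin n) F))
    (hmin : ∀ K : Subfield F, K ≠ ⊤ →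
      ¬ ∃ M : GL (Fin n) F, ∀ g : G, ∀ i j,
        ((↑(M⁻¹ * ρ g * M) : Matrix (Fin n) (Fin n) F) i j) ∈ K) :
    -- (1) `ρ' ⊗_{𝔽_p} F` is `G`-equivariantly isomorphic to the direct sum of the twists `ρ^σ`
    (∃ e : (F ⊗[ZMod p] (Fin n → F)) ≃ₗ[F] ((F ≃+* F) → (Fin n → F)),
      ∀ g : G, ∀ x : F ⊗[ZMod p] (Fin n → F),
        e (LinearMap.baseChange F
            (((ρ g : Matrix (Fin n) (Fin n) F).mulVecLin).restrictScalars (ZMod p)) x)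
          = fun σ : F ≃+* F =>
              ((ρ g : Matrix (Fin n) (Fin n) F).map σ).mulVec (e x σ)) ∧
    -- (2) each twist `ρ^σ` is irreducible
    (∀ σ : F ≃+* F, ∀ U : Submodule F (Fin n → F),
      (∀ g : G, ∀ x ∈ U, ((ρ g : Matrix (Fin n) (Fin n) F).map σ).mulVec x ∈ U) →
      U = ⊥ ∨ U = ⊤) ∧
    -- (3) the twists are pairwise non-isomorphic
    (∀ σ τ : F ≃+* F, σ ≠ τ →
      ¬ ∃ M : GL (Fin n) F, ∀ g : G,
        (↑M : Matrix (Fin n) (Fin n) F) * (ρ g : Matrix (Fin n) (Fin n) F).map σ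
          = (ρ g : Matrix (Fin n) (Fin n) F).map τ * (↑M : Matrix (Fin n) (Fin n) F)) := by
  classical
  have hfin : Finite (F ≃+* F) := Finite.of_injective (fun e : F ≃+* F => (e : F → F))
    DFunLike.coe_injective
  have hmap : ∀ (σ : F ≃+* F) (A : Matrix (Fin n) (Fin n) F) (x : Fin n → F),
      (fun i => σ (A.mulVec x i)) = (A.map σ).mulVec (fun i => σ (x i)) := by
    intro σ A x
    ext i
    exact RingHom.map_mulVec (σ : F →+* F) A x i
  refine ⟨?_, ?_, ?_⟩
  · have : Fintype (F ≃+* F) := Fintype.ofFinite _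
    have hsz : ∀ (σ : F ≃+* F) (r : ZMod p) (x : F), σ (r • x) = r • σ x := by
      intro σ r x
      exact map_smul (AddMonoidHom.toZModLinearMap p (σ : F →+ F)) r x
    let T : (Fin n → F) →ₗ[ZMod p] ((F ≃+* F) → (Fin n → F)) :=
      { toFun := fun x σ i => σ (x i)
        map_add' := fun x y => by ext; simp
        map_smul' := fun r x => by ext σ i; exact hsz σ r (x i) }
    let E : (F ⊗[ZMod p] (Fin n → F)) →ₗ[F] ((F ≃+* F) → (Fin n → F)) :=
      T.liftBaseChange F
    have hE : ∀ a x, E (a ⊗ₜ x) = a • T x := fun a x => by simp [E]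
    have hsurj : Function.Surjective E := by
      rw [← LinearMap.range_eq_top]
      by_contra hlt
      obtain ⟨f, hf, hle⟩ := Submodule.exists_le_ker_of_lt_top _ (lt_top_iff_ne_top.mpr hlt)
      apply hf
      have hz : ∀ j σ, f (Pi.single σ (Pi.single j 1)) = 0 := by
        intro j
        refine aux_dedekind (fun σ : F ≃+* F => σ) (fun _ _ h => h) _ (fun x => ?_)
        have h1 : f (E (1 ⊗ₜ Pi.single j x)) = 0 := hle ⟨_, rfl⟩
        rw [hE, one_smul] at h1
        have h2 : T (Pi.single j x) =
            ∑ σ : F ≃+* F, σ x • (Pi.single σ (Pi.single j 1) : (F ≃+* F) → (Fin n → F)) := by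
          ext τ i
          rw [Finset.sum_apply, Finset.sum_apply, Finset.sum_eq_single τ]
          · by_cases hij : i = j
            · subst hij; simp [T]
            · simp [T, hij]
          · intro σ _ hσ
            simp [Pi.single_eq_of_ne hσ.symm]
          · simp
        rw [h2, map_sum] at h1
        rw [← h1]
        refine Finset.sum_congr rfl fun σ _ => ?_
        rw [map_smul, smul_eq_mul, mul_comm]
      refine LinearMap.pi_ext' fun σ => LinearMap.pi_ext' fun j => LinearMap.ext_ring ?_
      simpa using hz j σ
    have hfr : Module.finrank F (F ⊗[ZMod p] (Fin n → F)) =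
        Module.finrank F ((F ≃+* F) → (Fin n → F)) := by
      have hc : Nat.card (F ≃+* F) = Module.finrank (ZMod p) F := by
        rw [← IsGalois.card_aut_eq_finrank]
        exact Nat.card_congr
          { toFun := fun σ => AlgEquiv.ofRingEquiv (f := σ) (fun r => by
              rw [Algebra.algebraMap_eq_smul_one, hsz, map_one])
            invFun := fun σ => σ.toRingEquiv
            left_inv := fun σ => rfl
            right_inv := fun σ => rfl }
      rw [Module.finrank_baseChange, Module.finrank_pi_fintype, Module.finrank_pi_fintype]
      simp [← hc, mul_comm]
    have hbij : Function.Bijective E :=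
      ⟨(LinearMap.injective_iff_surjective_of_finrank_eq_finrank hfr).mpr hsurj, hsurj⟩
    refine ⟨LinearEquiv.ofBijective E hbij, fun g x => ?_⟩
    rw [LinearEquiv.ofBijective_apply, LinearEquiv.ofBijective_apply]
    induction x with
    | zero => ext; simp
    | add x y hx hy =>
      rw [map_add, map_add, hx, hy, map_add]
      ext σ : 1
      exact (Matrix.mulVec_add _ _ _).symm
    | tmul a x =>
      rw [LinearMap.baseChange_tmul, hE, hE]
      ext σ : 1
      change a • (fun i => σ ((ρ g : Matrix (Fin n) (Fin n) F).mulVec x i)) =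
        ((ρ g : Matrix (Fin n) (Fin n) F).map σ).mulVec (a • (fun i => σ (x i)))
      rw [hmap, Matrix.mulVec_smul]
  · intro σ U hU
    let U' : Submodule F (Fin n → F) :=
      { carrier := {x | (fun i => σ (x i)) ∈ U}
        zero_mem' := by
          change (fun i => σ ((0 : Fin n → F) i)) ∈ U
          convert U.zero_mem using 1
          ext; simp
        add_mem' := fun {x y} hx hy => by
          change (fun i => σ ((x + y) i)) ∈ U
          convert U.add_mem hx hy using 1
          ext; simp
        smul_mem' := fun c x hx => by
          change (fun i => σ ((c • x) i)) ∈ U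
          convert U.smul_mem (σ c) hx using 1
          ext; simp }
    have hU' : ∀ x, x ∈ U' ↔ (fun i => σ (x i)) ∈ U := fun x => Iff.rfl
    have hback : ∀ x ∈ U, (fun i => σ.symm (x i)) ∈ U' := by
      intro x hx
      rw [hU']
      simpa using hx
    rcases hirr U' (fun g x hx => by
      rw [hU', hmap]
      exact hU g _ hx) with h | h
    · left
      rw [eq_bot_iff]
      intro x hx
      have h1 := hback x hx
      rw [h, Submodule.mem_bot] at h1
      rw [Submodule.mem_bot]
      ext i
      have h2 := congrFun h1 i
      simpa using h2
    · right
      rw [eq_top_iff]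
      intro x _
      have h1 : (fun i => σ.symm (x i)) ∈ U' := by rw [h]; trivial
      rw [hU'] at h1
      simpa using h1
  · rintro σ τ hστ ⟨M, hM⟩
    let α : F ≃+* F := τ.trans σ.symm
    have hα : ∃ x, α x ≠ x := by
      by_contra! hcon
      apply hστ
      ext x
      have h1 := hcon x
      change σ.symm (τ x) = x at h1
      exact (σ.symm_apply_eq.mp h1).symm
    obtain ⟨P, hP⟩ := aux_realize α ρ hcomm
      (Matrix.GeneralLinearGroup.map (σ.symm : F →+* F) M) (fun g => by
        have h1 := congrArg (fun A : Matrix (Fin n) (Fin n) F => A.map σ.symm) (hM g)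
        simp only [Matrix.map_mul, Matrix.map_map] at h1
        have h2 : (ρ g : Matrix (Fin n) (Fin n) F).map (σ.symm ∘ σ) = ρ g := by
          ext; simp
        rw [h2] at h1
        exact h1)
    obtain ⟨x, hx⟩ := hα
    refine hmin ((α : F →+* F).eqLocusField (RingHom.id F)) ?_ ⟨P, fun g i j => hP g i j⟩
    intro htop
    apply hx
    have : x ∈ (α : F →+* F).eqLocusField (RingHom.id F) := by rw [htop]; trivial
    exact this
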